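/- arXiv:2511.21556 — 7 statements merged into one kernel-verified Lean document; each statement's English description precedes it below -/
import Mathlib

section
/- Let (Ω, ℱ, P) be a probability space and X : Ω → ℝ a nonnegative random variable with E[X²] < ∞, and define g(m) := E[min(X², (X − m)²)] for m ∈ ℝ. If P(X > 0) > 0, then there exists m* > 0 such that g(m*) = inf{ g(m) : m ≥ 0 }, i.e. the constrained two-point quantization problem with one knot fixed at zero admits a minimizer, and g(m*) < E[X²] so that every minimizer is strictly positive. -/
open MeasureTheory

open Filter Topology

section Distortion

variable {Ω : Type*} [MeasurableSpace Ω] {P : Measure Ω} {X : Ω → ℝ}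

lemma aestronglyMeasurable_min_sq (hX : Measurable X) (m : ℝ) :
    AEStronglyMeasurable (fun ω => min ((X ω) ^ 2) ((X ω - m) ^ 2)) P :=
  ((hX.pow_const 2).min ((hX.sub_const m).pow_const 2)).aestronglyMeasurable

lemma norm_min_sq_le (x m : ℝ) : ‖min (x ^ 2) ((x - m) ^ 2)‖ ≤ x ^ 2 := by
  rw [Real.norm_of_nonneg (by positivity)]
  exact min_le_left _ _

lemma integrable_min_sq (hX : Measurable X) (hX2 : Integrable (fun ω => (X ω) ^ 2) P) (m : ℝ) :
    Integrable (fun ω => min ((X ω) ^ 2) ((X ω - m) ^ 2)) P :=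
  hX2.mono' (aestronglyMeasurable_min_sq hX m) (ae_of_all _ fun ω => norm_min_sq_le (X ω) m)

lemma continuous_integral_min_sq (hX : Measurable X)
    (hX2 : Integrable (fun ω => (X ω) ^ 2) P) :
    Continuous fun m : ℝ => ∫ ω, min ((X ω) ^ 2) ((X ω - m) ^ 2) ∂P :=
  continuous_of_dominated (aestronglyMeasurable_min_sq hX)
    (fun m => ae_of_all _ fun ω => norm_min_sq_le (X ω) m) hX2
    (ae_of_all _ fun ω => by fun_prop)

lemma tendsto_integral_min_sq_atTop (hX : Measurable X)
    (hX2 : Integrable (fun ω => (X ω) ^ 2) P) :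
    Tendsto (fun m : ℝ => ∫ ω, min ((X ω) ^ 2) ((X ω - m) ^ 2) ∂P) atTop
      (𝓝 (∫ ω, (X ω) ^ 2 ∂P)) := by
  refine tendsto_integral_filter_of_dominated_convergence _
    (Eventually.of_forall (aestronglyMeasurable_min_sq hX))
    (Eventually.of_forall fun m => ae_of_all _ fun ω => norm_min_sq_le (X ω) m) hX2
    (ae_of_all _ fun ω => tendsto_const_nhds.congr' ?_)
  filter_upwards [eventually_ge_atTop (2 * X ω), eventually_ge_atTop 0] with m hm hm0
  exact (min_eq_left (by nlinarith)).symm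

lemma exists_pos_measure_lt_pos (hpos : 0 < P {ω | 0 < X ω}) :
    ∃ a : ℝ, 0 < a ∧ 0 < P {ω | a < X ω} := by
  by_contra! h
  refine hpos.ne' (measure_mono_null (t := ⋃ n : ℕ, {ω | 1 / ((n : ℝ) + 1) < X ω}) ?_ ?_)
  · intro ω (hω : 0 < X ω)
    obtain ⟨n, hn⟩ := exists_nat_one_div_lt hω
    exact Set.mem_iUnion.2 ⟨n, hn⟩
  · exact measure_iUnion_null fun n => nonpos_iff_eq_zero.1 (h _ (by positivity))

lemma integral_min_sq_lt (hX : Measurable X) (hX2 : Integrable (fun ω => (X ω) ^ 2) P)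
    {a : ℝ} (ha : 0 < a) (hP : 0 < P {ω | a < X ω}) :
    ∫ ω, min ((X ω) ^ 2) ((X ω - a) ^ 2) ∂P < ∫ ω, (X ω) ^ 2 ∂P := by
  have hint := integrable_min_sq hX hX2 a
  rw [← sub_pos, ← integral_sub hX2 hint, integral_pos_iff_support_of_nonneg
    (fun ω => sub_nonneg.2 (min_le_left _ _)) (hX2.sub hint)]
  refine hP.trans_le (measure_mono fun ω (hω : a < X ω) => ?_)
  exact (sub_pos.2 (min_lt_of_right_lt (by nlinarith))).ne'

end Distortion

/-- If `P (X > 0) > 0`, the constrained two-point quantization problem with one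
knot fixed at zero admits a minimizer `m* > 0` of
`g (m) = E[min (X², (X - m)²)]` over `m ≥ 0`, with `g (m*) < E[X²]`, so that
every minimizer is strictly positive. -/
theorem stmt10 {Ω : Type*} [MeasurableSpace Ω] (P : Measure Ω) [IsProbabilityMeasure P]
    (X : Ω → ℝ) (hXmeas : Measurable X) (hXnonneg : ∀ ω, 0 ≤ X ω)
    (hX2 : Integrable (fun ω => (X ω) ^ 2) P)
    (hpos : 0 < P {ω | 0 < X ω}) :
    ∃ m' : ℝ, 0 < m' ∧
      (∀ m : ℝ, 0 ≤ m →
        (∫ ω, min ((X ω) ^ 2) ((X ω - m') ^ 2) ∂P) ≤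
          ∫ ω, min ((X ω) ^ 2) ((X ω - m) ^ 2) ∂P) ∧
      (∫ ω, min ((X ω) ^ 2) ((X ω - m') ^ 2) ∂P) < ∫ ω, (X ω) ^ 2 ∂P := by
  obtain ⟨a, ha, hPa⟩ := exists_pos_measure_lt_pos hpos
  have hlt := integral_min_sq_lt hXmeas hX2 ha hPa
  obtain ⟨m', hm', hmin⟩ :=
    (continuous_integral_min_sq hXmeas hX2).continuousOn.exists_isMinOn' isClosed_Ici
      (Set.mem_Ici.2 ha.le) (by
        rw [cocompact_eq_atBot_atTop, inf_sup_right, eventually_sup]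
        constructor
        · rw [eventually_inf_principal]
          filter_upwards [eventually_lt_atBot 0] with m hm hm0
          exact absurd hm (not_lt.2 hm0)
        · exact (((tendsto_integral_min_sq_atTop hXmeas hX2).eventually_const_lt hlt).mono
            fun _ h => h.le).filter_mono inf_le_left)
  have hminlt : ∫ ω, min ((X ω) ^ 2) ((X ω - m') ^ 2) ∂P < ∫ ω, (X ω) ^ 2 ∂P :=
    (hmin (Set.mem_Ici.2 ha.le)).trans_lt hlt
  refine ⟨m', lt_of_le_of_ne hm' ?_, fun m hm => hmin hm, hminlt⟩
  rintro rfl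
  simp at hminlt
end

section
/- Let (Ω, ℱ, P) be a probability space and X : Ω → ℝ a nonnegative random variable with E[X²] < ∞, and define g(m) := E[min(X², (X − m)²)]. Let m > 0 be such that P(X = m/2) = 0. Then g is differentiable at m with g'(m) = 2·E[(m − X)·1_{X > m/2}]. -/
open MeasureTheory

open scoped Topology

/-- Away from the threshold `x = m / 2`, the two-point loss is differentiable in the second
point. -/
lemma hasDerivAt_min_sq_sub_sq {x m : ℝ} (hm : 0 < m) (hx : x ≠ m / 2) :
    HasDerivAt (fun t : ℝ => min (x ^ 2) ((x - t) ^ 2))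
      (if m / 2 < x then 2 * (m - x) else 0) m := by
  have hpos : ∀ᶠ t in 𝓝 m, 0 < t := lt_mem_nhds hm
  split_ifs with h
  · have hlt : ∀ᶠ t in 𝓝 m, t < 2 * x := gt_mem_nhds (by linarith)
    have hd : HasDerivAt (fun t : ℝ => (x - t) ^ 2) (2 * (m - x)) m :=
      (((hasDerivAt_id' m).const_sub x).pow 2).congr_deriv (by push_cast; ring)
    refine hd.congr_of_eventuallyEq ?_
    filter_upwards [hpos, hlt] with t ht ht'
    exact min_eq_right (by nlinarith)
  · have hlt : ∀ᶠ t in 𝓝 m, 2 * x < t :=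
      lt_mem_nhds (by linarith [lt_of_le_of_ne (not_lt.mp h) hx])
    refine (hasDerivAt_const m (x ^ 2)).congr_of_eventuallyEq ?_
    filter_upwards [hpos, hlt] with t ht ht'
    exact min_eq_left (by nlinarith)

/-- On a bounded interval, the two-point loss is Lipschitz in the second point. -/
lemma lipschitzOnWith_min_sq_sub_sq {x b : ℝ} (hx : 0 ≤ x) :
    LipschitzOnWith (Real.nnabs (2 * x + 2 * b)) (fun t : ℝ => min (x ^ 2) ((x - t) ^ 2))
      (Set.Ioo 0 b) := by
  refine LipschitzOnWith.of_dist_le_mul fun s hs t ht => ?_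
  obtain ⟨hs₀, hsb⟩ := hs
  obtain ⟨ht₀, htb⟩ := ht
  rw [Real.dist_eq, Real.dist_eq, Real.coe_nnabs]
  calc |min (x ^ 2) ((x - s) ^ 2) - min (x ^ 2) ((x - t) ^ 2)|
      ≤ |(x - s) ^ 2 - (x - t) ^ 2| :=
        (abs_min_sub_min_le_max _ _ _ _).trans (max_le (by simp) le_rfl)
    _ = |s + t - 2 * x| * |s - t| := by rw [← abs_mul]; ring_nf
    _ ≤ |2 * x + 2 * b| * |s - t| := by
        refine mul_le_mul_of_nonneg_right ?_ (abs_nonneg _)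
        rw [abs_of_nonneg (a := 2 * x + 2 * b) (by linarith), abs_le]
        constructor <;> linarith

/-- If `m > 0` and `P (X = m/2) = 0`, then the two-point distortion
`g (m) = E[min (X², (X - m)²)]` is differentiable at `m` with derivative
`g' (m) = 2 E[(m - X) · 1_{X > m/2}]`. -/
theorem stmt11 {Ω : Type*} [MeasurableSpace Ω] (P : Measure Ω) [IsProbabilityMeasure P]
    (X : Ω → ℝ) (hXmeas : Measurable X) (hXnonneg : ∀ ω, 0 ≤ X ω)
    (hX2 : Integrable (fun ω => (X ω) ^ 2) P)
    (m : ℝ) (hm : 0 < m) (hatom : P {ω | X ω = m / 2} = 0) :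
    HasDerivAt (fun m' : ℝ => ∫ ω, min ((X ω) ^ 2) ((X ω - m') ^ 2) ∂P)
      (2 * ∫ ω in {ω | m / 2 < X ω}, (m - X ω) ∂P) m := by
  have hXint : Integrable X P :=
    ((memLp_two_iff_integrable_sq hXmeas.aestronglyMeasurable).2 hX2).integrable one_le_two
  have hmeas : ∀ t : ℝ, AEStronglyMeasurable (fun ω => min ((X ω) ^ 2) ((X ω - t) ^ 2)) P :=
    fun t => by fun_prop
  have hset : MeasurableSet {ω | m / 2 < X ω} := measurableSet_lt measurable_const hXmeas
  have hint : Integrable (fun ω => min ((X ω) ^ 2) ((X ω - m) ^ 2)) P := by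
    refine hX2.mono' (hmeas m) (.of_forall fun ω => ?_)
    rw [Real.norm_of_nonneg (le_min (sq_nonneg _) (sq_nonneg _))]
    exact min_le_left _ _
  have hne : ∀ᵐ ω ∂P, X ω ≠ m / 2 := by
    rw [ae_iff]
    simpa using hatom
  have key := (hasDerivAt_integral_of_dominated_loc_of_lip
    (F' := fun ω => if m / 2 < X ω then 2 * (m - X ω) else 0)
    (bound := fun ω => 2 * X ω + 2 * (2 * m))
    (Ioo_mem_nhds hm (by linarith : m < 2 * m))
    (.of_forall hmeas) hint
    (Measurable.ite hset (by fun_prop) measurable_const).aestronglyMeasurable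
    (.of_forall fun ω => lipschitzOnWith_min_sq_sub_sq (hXnonneg ω))
    ((hXint.const_mul 2).add (integrable_const _))
    (hne.mono fun ω hω => hasDerivAt_min_sq_sub_sq hm hω)).2
  refine key.congr_deriv (Eq.symm ?_)
  rw [← integral_const_mul, ← integral_indicator hset]
  simp only [Set.indicator_apply, Set.mem_ofPred_eq]
end

section
/- Let (Ω, ℱ, P) be a probability space and X : Ω → ℝ a nonnegative random variable with E[X²] < ∞, and define g(m) := E[min(X², (X − m)²)]. Suppose m > 0 minimizes g over [0, ∞), and that P(X = m/2) = 0 and P(X > m/2) > 0. Then, writing a := m/2, the optimality condition E[X·1_{X > a}] = 2a·P(X > a) holds; equivalently m = E[X·1_{X > m/2}] / P(X > m/2), i.e. the optimal magnitude m equals the conditional expectation E[X | X > m/2] and satisfies the fixed-point equation 2a = E[X | X > a]. -/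
open MeasureTheory

/-- The distortion of the quantizer that sends `A` to `t` and its complement to `0`. -/
theorem integral_sq_add_indicator {Ω : Type*} [MeasurableSpace Ω] {P : Measure Ω}
    [IsFiniteMeasure P] {X : Ω → ℝ} (hX : Integrable X P)
    (hX2 : Integrable (fun ω => (X ω) ^ 2) P) {A : Set Ω} (hA : MeasurableSet A) (t : ℝ) :
    Integrable (fun ω => (X ω) ^ 2 + A.indicator (fun ω => t ^ 2 - 2 * t * X ω) ω) P ∧
    ∫ ω, ((X ω) ^ 2 + A.indicator (fun ω => t ^ 2 - 2 * t * X ω) ω) ∂P =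
      ∫ ω, (X ω) ^ 2 ∂P + (t ^ 2 * (P A).toReal - 2 * t * ∫ ω in A, X ω ∂P) := by
  have hlin : Integrable (fun ω => t ^ 2 - 2 * t * X ω) P :=
    (integrable_const _).sub (hX.const_mul _)
  refine ⟨hX2.add (hlin.indicator hA), ?_⟩
  rw [integral_add hX2 (hlin.indicator hA), integral_indicator hA,
    integral_sub (integrable_const _) (hX.const_mul _).integrableOn, integral_const_mul,
    setIntegral_const, smul_eq_mul, Measure.real, mul_comm (t ^ 2)]

/-- First-order optimality condition for the constrained two-point quantizer:
if `m > 0` minimizes `g (m) = E[min (X², (X - m)²)]` over `[0, ∞)`, with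
`P (X = m/2) = 0` and `P (X > m/2) > 0`, then writing `a := m/2` we have
`E[X · 1_{X > a}] = 2a · P (X > a)`; equivalently the optimal magnitude `m`
equals the conditional expectation `E[X | X > m/2]`, i.e. `2a = E[X | X > a]`. -/
theorem stmt12 {Ω : Type*} [MeasurableSpace Ω] (P : Measure Ω) [IsProbabilityMeasure P]
    (X : Ω → ℝ) (hXmeas : Measurable X) (hXnonneg : ∀ ω, 0 ≤ X ω)
    (hX2 : Integrable (fun ω => (X ω) ^ 2) P)
    (m : ℝ) (hm : 0 < m)
    (hmin : ∀ m' : ℝ, 0 ≤ m' →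
      (∫ ω, min ((X ω) ^ 2) ((X ω - m) ^ 2) ∂P) ≤
        ∫ ω, min ((X ω) ^ 2) ((X ω - m') ^ 2) ∂P)
    (hatom : P {ω | X ω = m / 2} = 0)
    (hpos : 0 < P {ω | m / 2 < X ω}) :
    (∫ ω in {ω | m / 2 < X ω}, X ω ∂P) =
        2 * (m / 2) * (P {ω | m / 2 < X ω}).toReal ∧
    m = (∫ ω in {ω | m / 2 < X ω}, X ω ∂P) / (P {ω | m / 2 < X ω}).toReal := by
  set A : Set Ω := {ω | m / 2 < X ω}
  have hA : MeasurableSet A := measurableSet_lt measurable_const hXmeas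
  have hX : Integrable X P :=
    ((memLp_two_iff_integrable_sq hXmeas.aestronglyMeasurable).2 hX2).integrable one_le_two
  have hp : 0 < (P A).toReal := ENNReal.toReal_pos hpos.ne' (measure_ne_top P A)
  have hI : 0 ≤ ∫ ω in A, X ω ∂P := integral_nonneg hXnonneg
  have hgm : ∫ ω, min ((X ω) ^ 2) ((X ω - m) ^ 2) ∂P =
      ∫ ω, ((X ω) ^ 2 + A.indicator (fun ω => m ^ 2 - 2 * m * X ω) ω) ∂P := by
    congr 1 with ω
    by_cases h : ω ∈ A
    · have h' : m / 2 < X ω := h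
      rw [Set.indicator_of_mem h, min_eq_right (by nlinarith)]
      ring
    · have h' : X ω ≤ m / 2 := not_lt.1 h
      rw [Set.indicator_of_notMem h, min_eq_left (by nlinarith), add_zero]
  have hle (t : ℝ) : ∫ ω, min ((X ω) ^ 2) ((X ω - t) ^ 2) ∂P ≤
      ∫ ω, ((X ω) ^ 2 + A.indicator (fun ω => t ^ 2 - 2 * t * X ω) ω) ∂P := by
    refine integral_mono_of_nonneg (.of_forall fun ω => le_min (sq_nonneg _) (sq_nonneg _))
      (integral_sq_add_indicator hX hX2 hA t).1 (.of_forall fun ω => ?_)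
    by_cases h : ω ∈ A
    · simp only [Set.indicator_of_mem h]
      exact (min_le_right _ _).trans_eq (by ring)
    · simp only [Set.indicator_of_notMem h, add_zero]
      exact min_le_left _ _
  -- Compare `m` with the conditional mean of `X` on `A`.
  have key := (hmin _ (div_nonneg hI hp.le)).trans (hle _)
  rw [hgm, (integral_sq_add_indicator hX hX2 hA _).2,
    (integral_sq_add_indicator hX hX2 hA _).2] at key
  set I := ∫ ω in A, X ω ∂P
  set p := (P A).toReal
  have hIp : I = I / p * p := (div_mul_cancel₀ I hp.ne').symm
  have hsq : p * (m - I / p) ^ 2 ≤ 0 := by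
    generalize I / p = c at key hIp ⊢
    rw [hIp] at key
    linarith
  have hmI : m = I / p :=
    sub_eq_zero.1 (pow_eq_zero_iff two_ne_zero |>.1
      (le_antisymm (nonpos_of_mul_nonpos_right hsq hp) (sq_nonneg _)))
  refine ⟨?_, hmI⟩
  rw [mul_div_cancel₀ m two_ne_zero, hmI, ← hIp]
end

section
/- Let (Ω, ℱ, P) be a probability space and X : Ω → ℝ a nonnegative random variable with E[X²] < ∞, and define D(m₁, m₂) := E[min(X², (X − m₁)², (X − m₂)²)]. Let 0 < x₁ < x₂ be real numbers with P(X = x₁/2) = 0 and P(X = (x₁ + x₂)/2) = 0. Then both partial derivatives of D exist at (x₁, x₂) and are given by ∂D/∂m₁ (x₁, x₂) = 2·E[(x₁ − X)·1_{x₁/2 < X < (x₁+x₂)/2}] and ∂D/∂m₂ (x₁, x₂) = 2·E[(x₂ − X)·1_{X > (x₁+x₂)/2}]. -/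
open MeasureTheory

theorem hasDerivAt_min_const_sub_sq {x y m : ℝ} (h : y ≠ (x - m) ^ 2) :
    HasDerivAt (fun t : ℝ => min y ((x - t) ^ 2))
      (if (x - m) ^ 2 < y then 2 * (m - x) else 0) m := by
  have hc : ContinuousAt (fun t : ℝ => (x - t) ^ 2) m := by fun_prop
  rcases lt_or_gt_of_ne h with h | h
  · rw [if_neg h.not_gt]
    refine (hasDerivAt_const m y).congr_of_eventuallyEq ?_
    filter_upwards [hc.eventually (lt_mem_nhds h)] with t ht
    exact min_eq_left ht.le
  · rw [if_pos h]
    have hd : HasDerivAt (fun t : ℝ => (x - t) ^ 2) (2 * (m - x)) m :=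
      (((hasDerivAt_id' m).const_sub x).fun_pow 2).congr_deriv (by norm_num; ring)
    refine hd.congr_of_eventuallyEq ?_
    filter_upwards [hc.eventually (gt_mem_nhds h)] with t ht
    exact min_eq_right ht.le

theorem lipschitzOnWith_min_const_sub_sq (x y m : ℝ) :
    LipschitzOnWith (Real.nnabs (2 * |x| + 2 * |m| + 2)) (fun t : ℝ => min y ((x - t) ^ 2))
      (Metric.ball m 1) := by
  refine LipschitzOnWith.of_dist_le_mul fun s hs t ht => ?_
  rw [Real.dist_eq, Real.dist_eq, Real.coe_nnabs,
    abs_of_nonneg (by positivity : (0 : ℝ) ≤ 2 * |x| + 2 * |m| + 2)]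
  rw [Metric.mem_ball, Real.dist_eq] at hs ht
  have hmin : |min y ((x - s) ^ 2) - min y ((x - t) ^ 2)| ≤ |(x - s) ^ 2 - (x - t) ^ 2| := by
    simpa using abs_min_sub_min_le_max y ((x - s) ^ 2) y ((x - t) ^ 2)
  have hfac : (x - s) ^ 2 - (x - t) ^ 2 = (s + t - 2 * x) * (s - t) := by ring
  have hsum : |s + t - 2 * x| ≤ 2 * |x| + 2 * |m| + 2 := by
    rw [abs_lt] at hs ht
    rw [abs_le]
    constructor <;>
      linarith [hs.1, hs.2, ht.1, ht.2, le_abs_self x, neg_abs_le x, le_abs_self m, neg_abs_le m]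
  rw [hfac, abs_mul] at hmin
  exact hmin.trans (mul_le_mul_of_nonneg_right hsum (abs_nonneg _))

theorem hasDerivAt_integral_min_sub_sq {Ω : Type*} [MeasurableSpace Ω] {P : Measure Ω}
    [IsFiniteMeasure P] {X Y : Ω → ℝ} (hX : Measurable X) (hY : Measurable Y)
    (hX2 : Integrable (fun ω => X ω ^ 2) P) (hY_int : Integrable Y P) {m : ℝ}
    (hne : ∀ᵐ ω ∂P, Y ω ≠ (X ω - m) ^ 2) :
    HasDerivAt (fun t : ℝ => ∫ ω, min (Y ω) ((X ω - t) ^ 2) ∂P)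
      (2 * ∫ ω in {ω | (X ω - m) ^ 2 < Y ω}, (m - X ω) ∂P) m := by
  have hX_memLp : MemLp X 2 P := (memLp_two_iff_integrable_sq hX.aestronglyMeasurable).2 hX2
  have hX_int : Integrable X P := hX_memLp.integrable (by norm_num)
  have hsq_int : Integrable (fun ω => (X ω - m) ^ 2) P :=
    (hX_memLp.sub (memLp_const m)).integrable_sq
  have hset : MeasurableSet {ω | (X ω - m) ^ 2 < Y ω} :=
    measurableSet_lt (by fun_prop) hY
  have hderiv := (hasDerivAt_integral_of_dominated_loc_of_lip (μ := P) (x₀ := m)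
    (F := fun t ω => min (Y ω) ((X ω - t) ^ 2))
    (F' := fun ω => if (X ω - m) ^ 2 < Y ω then 2 * (m - X ω) else 0)
    (bound := fun ω => 2 * |X ω| + 2 * |m| + 2)
    (Metric.ball_mem_nhds m one_pos)
    (Filter.Eventually.of_forall fun t =>
      (hY.min (by fun_prop : Measurable fun ω => (X ω - t) ^ 2)).aestronglyMeasurable)
    (hY_int.inf hsq_int)
    (Measurable.ite hset (by fun_prop) measurable_const).aestronglyMeasurable
    (Filter.Eventually.of_forall fun ω => lipschitzOnWith_min_const_sub_sq (X ω) (Y ω) m)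
    (((hX_int.abs.const_mul 2).add (integrable_const _)).add (integrable_const _))
    (hne.mono fun ω h => hasDerivAt_min_const_sub_sq h)).2
  rw [← integral_const_mul, ← integral_indicator hset]
  exact hderiv

theorem integrable_min_sq_sub_sq {Ω : Type*} [MeasurableSpace Ω] {P : Measure Ω}
    [IsFiniteMeasure P] {X : Ω → ℝ} (hX : Measurable X)
    (hX2 : Integrable (fun ω => X ω ^ 2) P) (a : ℝ) :
    Integrable (fun ω => min (X ω ^ 2) ((X ω - a) ^ 2)) P :=
  hX2.inf (((memLp_two_iff_integrable_sq hX.aestronglyMeasurable).2 hX2).sub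
    (memLp_const a)).integrable_sq

/-- Partial derivatives of the three-point distortion
`D (m₁, m₂) = E[min (X², (X - m₁)², (X - m₂)²)]` at a point `0 < x₁ < x₂` with
`P (X = x₁/2) = 0` and `P (X = (x₁+x₂)/2) = 0`:
`∂D/∂m₁ = 2 E[(x₁ - X) · 1_{x₁/2 < X < (x₁+x₂)/2}]` and
`∂D/∂m₂ = 2 E[(x₂ - X) · 1_{X > (x₁+x₂)/2}]`. -/
theorem stmt13 {Ω : Type*} [MeasurableSpace Ω] (P : Measure Ω) [IsProbabilityMeasure P]
    (X : Ω → ℝ) (hXmeas : Measurable X) (hXnonneg : ∀ ω, 0 ≤ X ω)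
    (hX2 : Integrable (fun ω => (X ω) ^ 2) P)
    (x₁ x₂ : ℝ) (hx₁ : 0 < x₁) (hx₁₂ : x₁ < x₂)
    (hatom1 : P {ω | X ω = x₁ / 2} = 0)
    (hatom2 : P {ω | X ω = (x₁ + x₂) / 2} = 0) :
    HasDerivAt (fun m₁ : ℝ =>
        ∫ ω, min ((X ω) ^ 2) (min ((X ω - m₁) ^ 2) ((X ω - x₂) ^ 2)) ∂P)
      (2 * ∫ ω in {ω | x₁ / 2 < X ω ∧ X ω < (x₁ + x₂) / 2}, (x₁ - X ω) ∂P) x₁ ∧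
    HasDerivAt (fun m₂ : ℝ =>
        ∫ ω, min ((X ω) ^ 2) (min ((X ω - x₁) ^ 2) ((X ω - m₂) ^ 2)) ∂P)
      (2 * ∫ ω in {ω | (x₁ + x₂) / 2 < X ω}, (x₂ - X ω) ∂P) x₂ := by
  have hY_meas (a : ℝ) : Measurable fun ω => min (X ω ^ 2) ((X ω - a) ^ 2) :=
    (by fun_prop : Measurable fun ω => X ω ^ 2).min (by fun_prop)
  have hne1 : ∀ᵐ ω ∂P, X ω ≠ x₁ / 2 := by simpa [ae_iff] using hatom1
  have hne2 : ∀ᵐ ω ∂P, X ω ≠ (x₁ + x₂) / 2 := by simpa [ae_iff] using hatom2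
  have lt_sq (x a b : ℝ) (hab : a < b) : (x - a) ^ 2 < (x - b) ^ 2 ↔ x < (a + b) / 2 := by
    constructor <;> intro h <;> nlinarith
  have gt_sq (x a b : ℝ) (hab : a < b) : (x - b) ^ 2 < (x - a) ^ 2 ↔ (a + b) / 2 < x := by
    constructor <;> intro h <;> nlinarith
  have lt_zero (x b : ℝ) (hb : 0 < b) : (x - b) ^ 2 < x ^ 2 ↔ b / 2 < x := by
    simpa using gt_sq x 0 b hb
  have eq_sq (x a b : ℝ) (hab : a < b) (h : (x - a) ^ 2 = (x - b) ^ 2) : x = (a + b) / 2 :=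
    le_antisymm (not_lt.1 fun h' => ((gt_sq x a b hab).2 h').ne' h)
      (not_lt.1 fun h' => ((lt_sq x a b hab).2 h').ne h)
  constructor
  · have hset : {ω | x₁ / 2 < X ω ∧ X ω < (x₁ + x₂) / 2} =
        {ω | (X ω - x₁) ^ 2 < min (X ω ^ 2) ((X ω - x₂) ^ 2)} := by
      ext ω
      simp only [Set.mem_ofPred_eq, lt_min_iff, lt_zero _ _ hx₁, lt_sq _ _ _ hx₁₂]
    have hfun (t : ℝ) (ω : Ω) : min (X ω ^ 2) (min ((X ω - t) ^ 2) ((X ω - x₂) ^ 2)) =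
        min (min (X ω ^ 2) ((X ω - x₂) ^ 2)) ((X ω - t) ^ 2) := by
      rw [min_assoc, min_comm ((X ω - x₂) ^ 2)]
    simp_rw [hfun, hset]
    refine hasDerivAt_integral_min_sub_sq hXmeas (hY_meas x₂) hX2
      (integrable_min_sq_sub_sq hXmeas hX2 x₂) ?_
    filter_upwards [hne1, hne2] with ω h1 h2 h
    rcases min_choice (X ω ^ 2) ((X ω - x₂) ^ 2) with h' | h' <;> rw [h'] at h
    · exact h1 (by simpa using eq_sq (X ω) 0 x₁ hx₁ (by simpa using h))
    · exact h2 (eq_sq _ _ _ hx₁₂ h.symm)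
  · have hset : {ω | (x₁ + x₂) / 2 < X ω} =
        {ω | (X ω - x₂) ^ 2 < min (X ω ^ 2) ((X ω - x₁) ^ 2)} := by
      ext ω
      simp only [Set.mem_ofPred_eq, lt_min_iff, lt_zero _ _ (hx₁.trans hx₁₂), gt_sq _ _ _ hx₁₂]
      exact ⟨fun h => ⟨by linarith, h⟩, fun h => h.2⟩
    simp_rw [← min_assoc, hset]
    refine hasDerivAt_integral_min_sub_sq hXmeas (hY_meas x₁) hX2
      (integrable_min_sq_sub_sq hXmeas hX2 x₁) ?_
    filter_upwards [hne2] with ω h2 h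
    rcases min_choice (X ω ^ 2) ((X ω - x₁) ^ 2) with h' | h' <;> rw [h'] at h
    · have hx : X ω = x₂ / 2 := by
        simpa using eq_sq (X ω) 0 x₂ (hx₁.trans hx₁₂) (by simpa using h)
      exact ((lt_zero (X ω) x₁ hx₁).2 (by linarith)).not_ge (min_eq_left_iff.1 h')
    · exact h2 (eq_sq _ _ _ hx₁₂ h)
end

section
/- Let (Ω, ℱ, P) be a probability space and X : Ω → ℝ a nonnegative random variable with E[X²] < ∞, and define D(m₁, m₂) := E[min(X², (X − m₁)², (X − m₂)²)]. Suppose (m₁, m₂) with 0 < m₁ < m₂ is a local minimizer of D, and that P(X = m₁/2) = 0 and P(X = (m₁ + m₂)/2) = 0. Then E[(m₁ − X)·1_{m₁/2 < X < (m₁+m₂)/2}] = 0 and E[(m₂ − X)·1_{X > (m₁+m₂)/2}] = 0. Consequently, if P(m₁/2 < X < (m₁+m₂)/2) > 0 and P(X > (m₁+m₂)/2) > 0, the optimal quantizers satisfy m₁ = E[X | m₁/2 < X < (m₁+m₂)/2] and m₂ = E[X | X > (m₁+m₂)/2]. -/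
open MeasureTheory

/-- If moving a parameter `s` away from a local minimizer `m` of `s ↦ ∫ f s` increases `f` by at
most the change of the squared error `(X - s) ^ 2` on `A`, then `m` is centered for `X` on `A`. -/
theorem setIntegral_sub_eq_zero_of_isLocalMin_of_le {Ω : Type*} [MeasurableSpace Ω]
    {P : Measure Ω} [IsFiniteMeasure P] {X : Ω → ℝ} (hX : Integrable X P) {A : Set Ω}
    (hA : MeasurableSet A) {f : ℝ → Ω → ℝ} (hf : ∀ s, Integrable (f s) P) {m : ℝ}
    (hmin : IsLocalMin (fun s => ∫ ω, f s ω ∂P) m)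
    (hle : ∀ s ω, f s ω ≤ f m ω + A.indicator (fun ω => (X ω - s) ^ 2 - (X ω - m) ^ 2) ω) :
    ∫ ω in A, (m - X ω) ∂P = 0 := by
  have hsub : Integrable (fun ω => m - X ω) (P.restrict A) :=
    ((integrable_const m).sub hX).integrableOn
  have hexpand : ∀ s : ℝ, (fun ω => (X ω - s) ^ 2 - (X ω - m) ^ 2) =
      fun ω => 2 * (s - m) * (m - X ω) + (s - m) ^ 2 := by
    intro s; ext ω; ring
  have hint : ∀ s : ℝ, IntegrableOn (fun ω => (X ω - s) ^ 2 - (X ω - m) ^ 2) A P := by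
    intro s
    rw [hexpand]
    exact (hsub.const_mul _).add (integrable_const _)
  have hbound : ∀ s : ℝ, ∫ ω, f s ω ∂P ≤ ∫ ω, f m ω ∂P +
      (2 * (s - m) * ∫ ω in A, (m - X ω) ∂P + P.real A * (s - m) ^ 2) := by
    intro s
    have hind := (hint s).integrable_indicator hA
    calc ∫ ω, f s ω ∂P
        ≤ ∫ ω, (f m ω + A.indicator (fun ω => (X ω - s) ^ 2 - (X ω - m) ^ 2) ω) ∂P :=
          integral_mono (hf s) ((hf m).add hind) (hle s)
      _ = _ := by
          rw [integral_add (hf m) hind, integral_indicator hA, hexpand,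
            integral_add (hsub.const_mul _) (integrable_const _), integral_const_mul]
          simp
  have hquad : IsLocalMin (fun s : ℝ =>
      2 * (s - m) * ∫ ω in A, (m - X ω) ∂P + P.real A * (s - m) ^ 2) m := by
    filter_upwards [hmin] with s hs
    have := hbound s
    simp only [sub_self, mul_zero, zero_mul, add_zero, ne_eq, OfNat.ofNat_ne_zero,
      not_false_eq_true, zero_pow]
    linarith
  have hid : HasDerivAt (fun s : ℝ => s - m) 1 m := (hasDerivAt_id m).sub_const m
  have hderiv := ((hid.const_mul 2).mul_const (∫ ω in A, (m - X ω) ∂P)).add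
    ((hid.pow 2).const_mul (P.real A))
  have := hquad.hasDerivAt_eq_zero hderiv
  simpa using this

/-- A constant whose deviation from `X` integrates to zero on a non-null set is the mean of `X`
there. -/
theorem eq_setIntegral_div_of_setIntegral_sub_eq_zero {Ω : Type*} [MeasurableSpace Ω]
    {P : Measure Ω} [IsFiniteMeasure P] {X : Ω → ℝ} (hX : Integrable X P) {A : Set Ω} {m : ℝ}
    (h : ∫ ω in A, (m - X ω) ∂P = 0) (hA : 0 < P A) :
    m = (∫ ω in A, X ω ∂P) / (P A).toReal := by
  have hpos : 0 < (P A).toReal := ENNReal.toReal_pos hA.ne' (measure_ne_top P A)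
  rw [integral_sub (integrable_const m) hX.integrableOn, setIntegral_const, smul_eq_mul,
    measureReal_def] at h
  rw [eq_div_iff hpos.ne']
  linarith

/-- First-order conditions for a local minimizer `(m₁, m₂)` with `0 < m₁ < m₂`
of the three-point distortion `D (m₁, m₂) = E[min (X², (X - m₁)², (X - m₂)²)]`,
under the no-atom assumptions `P (X = m₁/2) = 0`, `P (X = (m₁+m₂)/2) = 0`:
`E[(m₁ - X) · 1_{m₁/2 < X < (m₁+m₂)/2}] = 0` and
`E[(m₂ - X) · 1_{X > (m₁+m₂)/2}] = 0`; consequently, if the two cells have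
positive probability, `m₁ = E[X | m₁/2 < X < (m₁+m₂)/2]` and
`m₂ = E[X | X > (m₁+m₂)/2]`. -/
theorem stmt14 {Ω : Type*} [MeasurableSpace Ω] (P : Measure Ω) [IsProbabilityMeasure P]
    (X : Ω → ℝ) (hXmeas : Measurable X) (hXnonneg : ∀ ω, 0 ≤ X ω)
    (hX2 : Integrable (fun ω => (X ω) ^ 2) P)
    (m₁ m₂ : ℝ) (hm₁ : 0 < m₁) (hm₁₂ : m₁ < m₂)
    (hmin : IsLocalMin (fun m : ℝ × ℝ =>
      ∫ ω, min ((X ω) ^ 2) (min ((X ω - m.1) ^ 2) ((X ω - m.2) ^ 2)) ∂P)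
      ((m₁, m₂) : ℝ × ℝ))
    (hatom1 : P {ω | X ω = m₁ / 2} = 0)
    (hatom2 : P {ω | X ω = (m₁ + m₂) / 2} = 0) :
    (∫ ω in {ω | m₁ / 2 < X ω ∧ X ω < (m₁ + m₂) / 2}, (m₁ - X ω) ∂P) = 0 ∧
    (∫ ω in {ω | (m₁ + m₂) / 2 < X ω}, (m₂ - X ω) ∂P) = 0 ∧
    (0 < P {ω | m₁ / 2 < X ω ∧ X ω < (m₁ + m₂) / 2} →
      0 < P {ω | (m₁ + m₂) / 2 < X ω} →
      m₁ = (∫ ω in {ω | m₁ / 2 < X ω ∧ X ω < (m₁ + m₂) / 2}, X ω ∂P) /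
            (P {ω | m₁ / 2 < X ω ∧ X ω < (m₁ + m₂) / 2}).toReal ∧
      m₂ = (∫ ω in {ω | (m₁ + m₂) / 2 < X ω}, X ω ∂P) /
            (P {ω | (m₁ + m₂) / 2 < X ω}).toReal) := by
  have hX : Integrable X P :=
    ((memLp_two_iff_integrable_sq hXmeas.aestronglyMeasurable).2 hX2).integrable one_le_two
  have hf : ∀ a b : ℝ,
      Integrable (fun ω => min ((X ω) ^ 2) (min ((X ω - a) ^ 2) ((X ω - b) ^ 2))) P := by
    intro a b
    refine hX2.mono' (by fun_prop) (ae_of_all _ fun ω => ?_)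
    rw [Real.norm_of_nonneg (by positivity)]
    exact min_le_left _ _
  have hmin₁ : IsLocalMin (fun s : ℝ =>
      ∫ ω, min ((X ω) ^ 2) (min ((X ω - s) ^ 2) ((X ω - m₂) ^ 2)) ∂P) m₁ :=
    IsLocalMin.comp_continuous (g := fun s : ℝ => (s, m₂)) hmin (by fun_prop)
  have hmin₂ : IsLocalMin (fun s : ℝ =>
      ∫ ω, min ((X ω) ^ 2) (min ((X ω - m₁) ^ 2) ((X ω - s) ^ 2)) ∂P) m₂ :=
    IsLocalMin.comp_continuous (g := fun s : ℝ => (m₁, s)) hmin (by fun_prop)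
  have hcell₁ : ∫ ω in {ω | m₁ / 2 < X ω ∧ X ω < (m₁ + m₂) / 2}, (m₁ - X ω) ∂P = 0 := by
    refine setIntegral_sub_eq_zero_of_isLocalMin_of_le hX
      ((measurableSet_lt measurable_const hXmeas).inter
        (measurableSet_lt hXmeas measurable_const)) (fun s => hf s m₂) hmin₁ fun s ω => ?_
    by_cases h : m₁ / 2 < X ω ∧ X ω < (m₁ + m₂) / 2
    · rw [Set.indicator_of_mem (by exact h)]
      have h₀ : (X ω - m₁) ^ 2 ≤ X ω ^ 2 := by nlinarith
      have h₂ : (X ω - m₁) ^ 2 ≤ (X ω - m₂) ^ 2 := by nlinarith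
      rw [min_eq_left h₂, min_eq_right h₀, add_sub_cancel]
      exact (min_le_right _ _).trans (min_le_left _ _)
    · rw [Set.indicator_of_notMem (by exact h), add_zero]
      refine le_min (min_le_left _ _) (le_min ?_ ((min_le_right _ _).trans (min_le_right _ _)))
      rcases not_and_or.1 h with h | h
      · exact (min_le_left _ _).trans (by nlinarith)
      · exact ((min_le_right _ _).trans (min_le_right _ _)).trans (by nlinarith)
  have hcell₂ : ∫ ω in {ω | (m₁ + m₂) / 2 < X ω}, (m₂ - X ω) ∂P = 0 := by
    refine setIntegral_sub_eq_zero_of_isLocalMin_of_le hX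
      (measurableSet_lt measurable_const hXmeas) (fun s => hf m₁ s) hmin₂ fun s ω => ?_
    by_cases h : (m₁ + m₂) / 2 < X ω
    · rw [Set.indicator_of_mem (by exact h)]
      have h₀ : (X ω - m₂) ^ 2 ≤ X ω ^ 2 := by nlinarith
      have h₁ : (X ω - m₂) ^ 2 ≤ (X ω - m₁) ^ 2 := by nlinarith
      rw [min_eq_right h₁, min_eq_right h₀, add_sub_cancel]
      exact (min_le_right _ _).trans (min_le_right _ _)
    · rw [Set.indicator_of_notMem (by exact h), add_zero]
      have hm : min (X ω ^ 2) (min ((X ω - m₁) ^ 2) ((X ω - s) ^ 2)) ≤ (X ω - m₁) ^ 2 :=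
        (min_le_right _ _).trans (min_le_left _ _)
      exact le_min (min_le_left _ _) (le_min hm (hm.trans (by nlinarith)))
  exact ⟨hcell₁, hcell₂, fun h₁ h₂ =>
    ⟨eq_setIntegral_div_of_setIntegral_sub_eq_zero hX hcell₁ h₁,
      eq_setIntegral_div_of_setIntegral_sub_eq_zero hX hcell₂ h₂⟩⟩
end

section
/- Let (Ω, ℱ, P) be a probability space and X : Ω → ℝ a nonnegative random variable with E[X²] < ∞ and E[X] > 0, and define D(m₁, m₂) := E[min(X², (X − m₁)², (X − m₂)²)]. Then for all v₁ > 0 and v₂ > 0, the one-sided directional derivative lim_{t → 0⁺} (D(t·v₁, t·v₂) − E[X²]) / t exists and equals −2·max(v₁, v₂)·E[X] < 0. In particular, the point (0, 0) is not a critical point of the distortion and is not a local minimizer of D on [0, ∞)². -/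
open MeasureTheory Filter Topology

/-- Pointwise bounds on the three-point squared distance to `0`, `a` and `b`. -/
lemma min_sq_sub_bounds {x a b : ℝ} (hx : 0 ≤ x) (ha : 0 ≤ a) :
    x ^ 2 - 2 * max a b * x ≤ min (x ^ 2) (min ((x - a) ^ 2) ((x - b) ^ 2)) ∧
      min (x ^ 2) (min ((x - a) ^ 2) ((x - b) ^ 2)) ≤
        x ^ 2 - 2 * max a b * x + max a b ^ 2 := by
  have hax : a * x ≤ max a b * x := mul_le_mul_of_nonneg_right (le_max_left a b) hx
  have hbx : b * x ≤ max a b * x := mul_le_mul_of_nonneg_right (le_max_right a b) hx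
  refine ⟨le_min ?_ (le_min ?_ ?_), (min_le_right _ _).trans ?_⟩
  · nlinarith [mul_nonneg ha hx]
  · nlinarith [sq_nonneg a]
  · nlinarith [sq_nonneg b]
  · rcases max_choice a b with h | h <;> rw [h]
    · exact (min_le_left _ _).trans (by linarith [sub_sq x a])
    · exact (min_le_right _ _).trans (by linarith [sub_sq x b])

/-- First-order expansion of the three-point distortion at the origin, with quadratic error. -/
lemma integral_min_sq_sub_bounds {Ω : Type*} [MeasurableSpace Ω] {P : Measure Ω}
    [IsProbabilityMeasure P] {X : Ω → ℝ} (hXmeas : Measurable X) (hXnonneg : ∀ ω, 0 ≤ X ω)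
    (hX2 : Integrable (fun ω => (X ω) ^ 2) P) {a b : ℝ} (ha : 0 ≤ a) :
    (∫ ω, (X ω) ^ 2 ∂P) - 2 * max a b * ∫ ω, X ω ∂P ≤
        ∫ ω, min ((X ω) ^ 2) (min ((X ω - a) ^ 2) ((X ω - b) ^ 2)) ∂P ∧
      ∫ ω, min ((X ω) ^ 2) (min ((X ω - a) ^ 2) ((X ω - b) ^ 2)) ∂P ≤
        (∫ ω, (X ω) ^ 2 ∂P) - 2 * max a b * (∫ ω, X ω ∂P) + max a b ^ 2 := by
  have hX : Integrable X P :=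
    ((memLp_two_iff_integrable_sq hXmeas.aestronglyMeasurable).2 hX2).integrable one_le_two
  have hmin : Integrable
      (fun ω => min ((X ω) ^ 2) (min ((X ω - a) ^ 2) ((X ω - b) ^ 2))) P := by
    refine hX2.mono' (by fun_prop) (ae_of_all _ fun ω => ?_)
    rw [Real.norm_of_nonneg (by positivity)]
    exact min_le_left _ _
  have hlin : Integrable (fun ω => (X ω) ^ 2 - 2 * max a b * X ω) P :=
    hX2.sub (hX.const_mul _)
  have hint : ∫ ω, ((X ω) ^ 2 - 2 * max a b * X ω) ∂P =
      (∫ ω, (X ω) ^ 2 ∂P) - 2 * max a b * ∫ ω, X ω ∂P := by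
    rw [integral_sub hX2 (hX.const_mul _), integral_const_mul]
  constructor
  · rw [← hint]
    exact integral_mono hlin hmin fun ω => (min_sq_sub_bounds (hXnonneg ω) ha).1
  · calc _ ≤ ∫ ω, ((X ω) ^ 2 - 2 * max a b * X ω + max a b ^ 2) ∂P :=
          integral_mono hmin (hlin.add (integrable_const _))
            fun ω => (min_sq_sub_bounds (hXnonneg ω) ha).2
      _ = _ := by rw [integral_add hlin (integrable_const _), hint]; simp

/-- The origin is not a critical point of the three-point distortion
`D (m₁, m₂) = E[min (X², (X - m₁)², (X - m₂)²)]`: for all `v₁, v₂ > 0` the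
one-sided directional derivative at `(0,0)` along `(v₁, v₂)` exists and equals
`-2 · max v₁ v₂ · E[X] < 0`; in particular `(0, 0)` is not a local minimizer of
`D` on `[0, ∞)²`. -/
theorem stmt15 {Ω : Type*} [MeasurableSpace Ω] (P : Measure Ω) [IsProbabilityMeasure P]
    (X : Ω → ℝ) (hXmeas : Measurable X) (hXnonneg : ∀ ω, 0 ≤ X ω)
    (hX2 : Integrable (fun ω => (X ω) ^ 2) P)
    (hmean : 0 < ∫ ω, X ω ∂P) :
    (∀ v₁ v₂ : ℝ, 0 < v₁ → 0 < v₂ →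
      Tendsto (fun t : ℝ =>
          ((∫ ω, min ((X ω) ^ 2)
              (min ((X ω - t * v₁) ^ 2) ((X ω - t * v₂) ^ 2)) ∂P)
            - ∫ ω, (X ω) ^ 2 ∂P) / t)
        (𝓝[>] 0) (𝓝 (-2 * max v₁ v₂ * ∫ ω, X ω ∂P)) ∧
      -2 * max v₁ v₂ * (∫ ω, X ω ∂P) < 0) ∧
    ¬ IsLocalMinOn (fun m : ℝ × ℝ =>
        ∫ ω, min ((X ω) ^ 2) (min ((X ω - m.1) ^ 2) ((X ω - m.2) ^ 2)) ∂P)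
      (Set.Ici (0 : ℝ) ×ˢ Set.Ici (0 : ℝ)) ((0, 0) : ℝ × ℝ) := by
  constructor
  · intro v₁ v₂ hv₁ hv₂
    have hM : 0 < max v₁ v₂ := lt_max_of_lt_left hv₁
    refine ⟨?_, by nlinarith [mul_pos hM hmean]⟩
    have hupper : Tendsto (fun t : ℝ => -2 * max v₁ v₂ * (∫ ω, X ω ∂P) + t * max v₁ v₂ ^ 2)
        (𝓝[>] 0) (𝓝 (-2 * max v₁ v₂ * ∫ ω, X ω ∂P)) :=
      tendsto_nhdsWithin_of_tendsto_nhds (Continuous.tendsto' (by fun_prop) _ _ (by simp))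
    refine tendsto_of_tendsto_of_tendsto_of_le_of_le' tendsto_const_nhds hupper ?_ ?_
    all_goals
      filter_upwards [self_mem_nhdsWithin] with t (ht : 0 < t)
      obtain ⟨hl, hu⟩ := integral_min_sq_sub_bounds hXmeas hXnonneg hX2
        (a := t * v₁) (b := t * v₂) (by positivity)
      rw [← mul_max_of_nonneg _ _ ht.le] at hl hu
    · rw [le_div_iff₀ ht]
      linarith
    · rw [div_le_iff₀ ht]
      linarith
  · intro h
    have hdiag : Tendsto (fun t : ℝ => (t, t)) (𝓝[>] 0)
        (𝓝[Set.Ici (0 : ℝ) ×ˢ Set.Ici (0 : ℝ)] ((0, 0) : ℝ × ℝ)) := by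
      refine tendsto_nhdsWithin_iff.2 ⟨tendsto_nhdsWithin_of_tendsto_nhds
        (Continuous.tendsto' (by fun_prop) _ _ rfl), ?_⟩
      filter_upwards [self_mem_nhdsWithin] with t (ht : 0 < t)
      exact ⟨ht.le, ht.le⟩
    obtain ⟨t, hmin, ht, htE⟩ :=
      ((hdiag.eventually h).and (Ioo_mem_nhdsGT hmean)).exists
    have hu := (integral_min_sq_sub_bounds hXmeas hXnonneg hX2 (a := t) (b := t) ht.le).2
    simp only [sub_zero, min_self] at hmin
    simp only [min_self, max_self] at hu
    nlinarith [mul_pos ht hmean]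
end

section
/- Let (Ω, ℱ, P) be a probability space and X : Ω → ℝ a nonnegative random variable with E[X²] < ∞ and E[X] > 0, and define D(m₁, m₂) := E[min(X², (X − m₁)², (X − m₂)²)]. Let x₂ > 0 be such that P(2X < x₂) = 1. Then for every v₁ > 0, the one-sided directional derivative lim_{t → 0⁺} (D(t·v₁, x₂) − D(0, x₂)) / t exists and equals −2·v₁·E[X] < 0. In particular, the boundary point (0, x₂) with x₂ > 2X almost surely is not a critical point of the distortion and is not a local minimizer of D on [0, ∞)². -/
open MeasureTheory Filter Topology

/-- Two-sided bound `E[X²] - 2 s E[X] ≤ D (s, x₂) ≤ E[X²] - 2 s E[X] + s²` on the three-point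
distortion when `2 X < x₂` almost surely. -/
theorem distortion_bounds {Ω : Type*} [MeasurableSpace Ω] {P : Measure Ω} [IsProbabilityMeasure P]
    {X : Ω → ℝ} (hXmeas : Measurable X) (hXnonneg : ∀ ω, 0 ≤ X ω)
    (hX2 : Integrable (fun ω => (X ω) ^ 2) P) {x₂ : ℝ} (hx₂ : 0 < x₂)
    (hbound : ∀ᵐ ω ∂P, 2 * X ω < x₂) {s : ℝ} (hs : 0 ≤ s) :
    (∫ ω, (X ω) ^ 2 ∂P) - 2 * s * (∫ ω, X ω ∂P) ≤
        ∫ ω, min ((X ω) ^ 2) (min ((X ω - s) ^ 2) ((X ω - x₂) ^ 2)) ∂P ∧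
      ∫ ω, min ((X ω) ^ 2) (min ((X ω - s) ^ 2) ((X ω - x₂) ^ 2)) ∂P ≤
        (∫ ω, (X ω) ^ 2 ∂P) - 2 * s * (∫ ω, X ω ∂P) + s ^ 2 := by
  have hX : Integrable X P :=
    ((memLp_two_iff_integrable_sq hXmeas.aestronglyMeasurable).2 hX2).integrable one_le_two
  have hmin : Integrable
      (fun ω => min ((X ω) ^ 2) (min ((X ω - s) ^ 2) ((X ω - x₂) ^ 2))) P := by
    refine hX2.mono' (by fun_prop) (Eventually.of_forall fun ω => ?_)
    rw [Real.norm_of_nonneg (by positivity)]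
    exact min_le_left _ _
  have hlin : Integrable (fun ω => (X ω) ^ 2 - 2 * s * X ω) P := hX2.sub (hX.const_mul _)
  have hint : ∫ ω, ((X ω) ^ 2 - 2 * s * X ω) ∂P =
      (∫ ω, (X ω) ^ 2 ∂P) - 2 * s * (∫ ω, X ω ∂P) := by
    rw [integral_sub hX2 (hX.const_mul _), integral_const_mul]
  constructor
  · rw [← hint]
    refine integral_mono_ae hlin hmin ?_
    filter_upwards [hbound] with ω hω
    have hsX : 0 ≤ s * X ω := mul_nonneg hs (hXnonneg ω)
    refine le_min (by linarith) (le_min (by nlinarith [sq_nonneg s]) ?_)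
    nlinarith [mul_pos hx₂ (sub_pos.2 hω)]
  · have hsq : ∫ ω, ((X ω) ^ 2 - 2 * s * X ω + s ^ 2) ∂P =
        (∫ ω, (X ω) ^ 2 ∂P) - 2 * s * (∫ ω, X ω ∂P) + s ^ 2 := by
      rw [integral_add hlin (integrable_const _), hint]
      simp
    rw [← hsq]
    refine integral_mono hmin (hlin.add (integrable_const _)) fun ω => ?_
    exact (min_le_right _ _).trans ((min_le_left _ _).trans (by nlinarith))

/-- The boundary point `(0, x₂)` with `x₂ > 2X` almost surely is not a critical
point of the three-point distortion
`D (m₁, m₂) = E[min (X², (X - m₁)², (X - m₂)²)]`: for every `v₁ > 0` the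
one-sided directional derivative at `(0, x₂)` along `(v₁, 0)` exists and equals
`-2 v₁ E[X] < 0`; in particular `(0, x₂)` is not a local minimizer of `D` on
`[0, ∞)²`. -/
theorem stmt16 {Ω : Type*} [MeasurableSpace Ω] (P : Measure Ω) [IsProbabilityMeasure P]
    (X : Ω → ℝ) (hXmeas : Measurable X) (hXnonneg : ∀ ω, 0 ≤ X ω)
    (hX2 : Integrable (fun ω => (X ω) ^ 2) P)
    (hmean : 0 < ∫ ω, X ω ∂P)
    (x₂ : ℝ) (hx₂ : 0 < x₂) (hbound : P {ω | 2 * X ω < x₂} = 1) :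
    (∀ v₁ : ℝ, 0 < v₁ →
      Tendsto (fun t : ℝ =>
          ((∫ ω, min ((X ω) ^ 2)
              (min ((X ω - t * v₁) ^ 2) ((X ω - x₂) ^ 2)) ∂P)
            - ∫ ω, min ((X ω) ^ 2) (min ((X ω - 0) ^ 2) ((X ω - x₂) ^ 2)) ∂P) / t)
        (𝓝[>] 0) (𝓝 (-2 * v₁ * ∫ ω, X ω ∂P)) ∧
      -2 * v₁ * (∫ ω, X ω ∂P) < 0) ∧
    ¬ IsLocalMinOn (fun m : ℝ × ℝ =>
        ∫ ω, min ((X ω) ^ 2) (min ((X ω - m.1) ^ 2) ((X ω - m.2) ^ 2)) ∂P)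
      (Set.Ici (0 : ℝ) ×ˢ Set.Ici (0 : ℝ)) ((0, x₂) : ℝ × ℝ) := by
  have hae : ∀ᵐ ω ∂P, 2 * X ω < x₂ :=
    (mem_ae_iff_prob_eq_one (measurableSet_lt (by fun_prop) measurable_const)).2 hbound
  have hD {s : ℝ} (hs : 0 ≤ s) := distortion_bounds hXmeas hXnonneg hX2 hx₂ hae hs
  have hD0 := hD le_rfl
  refine ⟨fun v₁ hv => ⟨?_, by nlinarith [mul_pos hv hmean]⟩, fun hloc => ?_⟩
  · have hup : Tendsto (fun t : ℝ => -2 * v₁ * (∫ ω, X ω ∂P) + t * v₁ ^ 2) (𝓝[>] 0)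
        (𝓝 (-2 * v₁ * ∫ ω, X ω ∂P)) := by
      refine tendsto_nhdsWithin_of_tendsto_nhds (Continuous.tendsto' (by fun_prop) _ _ ?_)
      simp
    refine tendsto_of_tendsto_of_tendsto_of_le_of_le' tendsto_const_nhds hup ?_ ?_ <;>
      filter_upwards [self_mem_nhdsWithin] with t (ht : 0 < t)
    · rw [le_div_iff₀ ht]
      have := (hD (mul_pos ht hv).le).1
      linarith
    · rw [div_le_iff₀ ht]
      have := (hD (mul_pos ht hv).le).2
      linarith
  · have hcurve : Tendsto (fun t : ℝ => (t, x₂)) (𝓝[>] 0)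
        (𝓝[Set.Ici (0 : ℝ) ×ˢ Set.Ici (0 : ℝ)] (0, x₂)) := by
      refine tendsto_nhdsWithin_iff.2 ⟨tendsto_nhdsWithin_of_tendsto_nhds
        (Continuous.tendsto' (by fun_prop) _ _ rfl), ?_⟩
      filter_upwards [self_mem_nhdsWithin] with t (ht : 0 < t)
      exact ⟨ht.le, hx₂.le⟩
    obtain ⟨t, hmin, ht0, htm⟩ :=
      ((hcurve.eventually hloc).and (Ioo_mem_nhdsGT hmean)).exists
    have := (hD ht0.le).2
    dsimp only at hmin
    nlinarith [mul_pos ht0 hmean, mul_pos ht0 (sub_pos.2 htm)]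
end
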